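/- Let f : [0,1]⁴ → ℝ be a continuous strictly positive probability density. Denote its univariate marginal densities f₁,…,f₄ with CDFs F_i, its bivariate and trivariate marginal densities by integrating out the remaining coordinates, and define the conditional distribution functions F_{i|j}(x_i|x_j) = (∫₀^{x_i} f_{ij}(t, x_j) dt)/f_j(x_j) and F_{i|23}(x_i|x₂,x₃) = (∫₀^{x_i} f_{i23}(t,x₂,x₃) dt)/f₂₃(x₂,x₃). Then there exist copula densities c₁₂, c₂₃, c₃₄ on [0,1]², continuous families c₁₃|₂(·,·;x₂), c₂₄|₃(·,·;x₃) of copula densities indexed by one conditioning variable, and a continuous family c₁₄|₂₃(·,·;x₂,x₃) of copula densities indexed by two conditioning variables, such that for all (x₁,x₂,x₃,x₄) ∈ [0,1]⁴: f(x₁,x₂,x₃,x₄) = f₁(x₁)f₂(x₂)f₃(x₃)f₄(x₄) · c₁₂(F₁(x₁),F₂(x₂)) · c₂₃(F₂(x₂),F₃(x₃)) · c₃₄(F₃(x₃),F₄(x₄)) · c₁₃|₂(F_{1|2}(x₁|x₂), F_{3|2}(x₃|x₂); x₂) · c₂₄|₃(F_{2|3}(x₂|x₃), F_{4|3}(x₄|x₃);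 x₃) · c₁₄|₂₃(F_{1|23}(x₁|x₂,x₃), F_{4|23}(x₄|x₂,x₃); x₂,x₃). -/

import Mathlib

open MeasureTheory

/-- A copula density on `[0,1]²`: a continuous nonnegative function whose horizontal and
vertical sections all integrate to `1`. -/
def IsCopulaDensity (c : ℝ → ℝ → ℝ) : Prop :=
  ContinuousOn (fun p : ℝ × ℝ => c p.1 p.2) ((Set.Icc (0:ℝ) 1) ×ˢ (Set.Icc (0:ℝ) 1)) ∧
  (∀ u ∈ Set.Icc (0:ℝ) 1, ∀ v ∈ Set.Icc (0:ℝ) 1, 0 ≤ c u v) ∧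
  (∀ u ∈ Set.Icc (0:ℝ) 1, ∫ v in (0:ℝ)..1, c u v = 1) ∧
  (∀ v ∈ Set.Icc (0:ℝ) 1, ∫ u in (0:ℝ)..1, c u v = 1)

/-- The retraction of the real line onto the unit interval. -/
noncomputable def clampUnit (x : ℝ) : ℝ := Set.projIcc (0 : ℝ) 1 zero_le_one x

lemma clampUnit_mem (x : ℝ) : clampUnit x ∈ Set.Icc (0 : ℝ) 1 := Subtype.prop _

lemma clampUnit_of_mem {x : ℝ} (hx : x ∈ Set.Icc (0 : ℝ) 1) : clampUnit x = x := by
  simp [clampUnit, Set.projIcc_of_mem _ hx]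

lemma continuous_clampUnit : Continuous clampUnit :=
  continuous_subtype_val.comp continuous_projIcc

lemma integral_comp_clampUnit (h : ℝ → ℝ) {x : ℝ} (hx : x ∈ Set.Icc (0 : ℝ) 1) :
    ∫ t in (0 : ℝ)..x, h (clampUnit t) = ∫ t in (0 : ℝ)..x, h t := by
  refine intervalIntegral.integral_congr fun t ht => ?_
  rw [Set.uIcc_of_le hx.1] at ht
  simp only [clampUnit_of_mem ⟨ht.1, ht.2.trans hx.2⟩]

lemma integral_swap_of_continuous {h : ℝ → ℝ → ℝ} (hh : Continuous fun p : ℝ × ℝ => h p.1 p.2) :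
    ∫ s in (0 : ℝ)..1, ∫ t in (0 : ℝ)..1, h s t = ∫ t in (0 : ℝ)..1, ∫ s in (0 : ℝ)..1, h s t := by
  simp only [intervalIntegral.integral_of_le (zero_le_one' ℝ)]
  apply MeasureTheory.integral_integral_swap
  rw [Measure.prod_restrict]
  exact (hh.continuousOn.integrableOn_compact
    (isCompact_Icc.prod isCompact_Icc)).mono_set
      (Set.prod_mono Set.Ioc_subset_Icc_self Set.Ioc_subset_Icc_self)

lemma integral_rotate_of_continuous {h : ℝ → ℝ → ℝ → ℝ}
    (hh : Continuous fun p : ℝ × ℝ × ℝ => h p.1 p.2.1 p.2.2) :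
    ∫ s in (0 : ℝ)..1, ∫ t in (0 : ℝ)..1, ∫ w in (0 : ℝ)..1, h s t w
      = ∫ w in (0 : ℝ)..1, ∫ s in (0 : ℝ)..1, ∫ t in (0 : ℝ)..1, h s t w := by
  have inner (s : ℝ) : ∫ t in (0 : ℝ)..1, ∫ w in (0 : ℝ)..1, h s t w
      = ∫ w in (0 : ℝ)..1, ∫ t in (0 : ℝ)..1, h s t w :=
    integral_swap_of_continuous (hh.comp (by fun_prop : Continuous fun p : ℝ × ℝ => (s, p.1, p.2)))
  simp only [inner]
  apply integral_swap_of_continuous (h := fun s w => ∫ t in (0 : ℝ)..1, h s t w)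
  exact intervalIntegral.continuous_parametric_intervalIntegral_of_continuous'
    (f := fun (p : ℝ × ℝ) t => h p.1 t p.2)
    (hh.comp (by fun_prop : Continuous fun q : (ℝ × ℝ) × ℝ => (q.1.1, q.2, q.1.2))) 0 1

section Copula

variable {Y : Type*} [TopologicalSpace Y]

/-- A jointly continuous quantile function for a continuous family of positive densities. -/
lemma exists_continuous_quantile {a : ℝ → Y → ℝ} {m : Y → ℝ}
    (ha : Continuous fun p : ℝ × Y => a p.1 p.2) (hapos : ∀ x y, 0 < a x y)
    (hm : ∀ y, m y = ∫ x in (0 : ℝ)..1, a x y) :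
    ∃ Q : ℝ → Y → ℝ, (Continuous fun p : ℝ × Y => Q p.1 p.2) ∧
      (∀ x ∈ Set.Icc (0 : ℝ) 1, ∀ y, Q ((∫ t in (0 : ℝ)..x, a t y) / m y) y = x) ∧
      ∀ y, ∀ h : ℝ → ℝ, Continuous h →
        ∫ u in (0 : ℝ)..1, h (Q u y) * (m y / a (Q u y) y) = ∫ x in (0 : ℝ)..1, h x := by
  have hay (y : Y) : Continuous fun x => a x y :=
    ha.comp (by fun_prop : Continuous fun x : ℝ => (x, y))
  have hint (y : Y) (s t : ℝ) : IntervalIntegrable (fun x => a x y) volume s t :=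
    (hay y).intervalIntegrable s t
  have hmpos (y : Y) : 0 < m y := by
    rw [hm]
    exact intervalIntegral.intervalIntegral_pos_of_pos (hint y 0 1) (hapos · y) one_pos
  have hacont (x : ℝ) : Continuous fun y => ∫ t in (0 : ℝ)..x, a t y :=
    intervalIntegral.continuous_parametric_intervalIntegral_of_continuous'
      (f := fun y t => a t y) (ha.comp continuous_swap) 0 x
  have hmcont : Continuous m := by
    simpa only [← hm] using hacont 1
  set A : ℝ → Y → ℝ := fun x y => (∫ t in (0 : ℝ)..x, a t y) / m y with hA
  have hAcont (x : ℝ) : Continuous (A x) := (hacont x).div hmcont fun y => (hmpos y).ne'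
  have hAderiv (x : ℝ) (y : Y) : HasDerivAt (A · y) (a x y / m y) x :=
    (intervalIntegral.integral_hasDerivAt_right (hint y 0 x)
      (hay y).stronglyMeasurable.stronglyMeasurableAtFilter (hay y).continuousAt).div_const _
  have hAmono (y : Y) : StrictMono (A · y) :=
    strictMono_of_hasDerivAt_pos (hAderiv · y) fun x => div_pos (hapos x y) (hmpos y)
  have hA0 (y : Y) : A 0 y = 0 := by simp [hA]
  have hA1 (y : Y) : A 1 y = 1 := by simp [hA, ← hm, (hmpos y).ne']
  have hAsurj (u : ℝ) (y : Y) : ∃ x, A x y = clampUnit u := by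
    have hu := clampUnit_mem u
    rw [← hA0 y, ← hA1 y] at hu
    obtain ⟨x, -, hx⟩ := intermediate_value_Icc zero_le_one
      (f := (A · y)) (fun x _ => (hAderiv x y).continuousAt.continuousWithinAt) hu
    exact ⟨x, hx⟩
  choose Q hQ using hAsurj
  have hQA (x : ℝ) (hx : x ∈ Set.Icc (0 : ℝ) 1) (y : Y) : Q (A x y) y = x := by
    apply (hAmono y).injective
    simp only [hQ]
    refine clampUnit_of_mem ⟨?_, ?_⟩
    · rw [← hA0 y]; exact (hAmono y).monotone hx.1
    · rw [← hA1 y]; exact (hAmono y).monotone hx.2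
  have hQcont : Continuous fun p : ℝ × Y => Q p.1 p.2 := by
    rw [continuous_iff_continuousAt]
    rintro ⟨u, y⟩
    have hclamp : Continuous fun p : ℝ × Y => clampUnit p.1 :=
      continuous_clampUnit.comp continuous_fst
    refine tendsto_order.2 ⟨fun l hl => ?_, fun r hr => ?_⟩
    · have : A l y < clampUnit u := by rw [← hQ u y]; exact hAmono y hl
      filter_upwards [((hAcont l).comp continuous_snd).continuousAt.eventually_lt
        (x₀ := (u, y)) hclamp.continuousAt this] with p hp
      rw [← hQ p.1 p.2] at hp
      exact (hAmono p.2).lt_iff_lt.1 hp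
    · have : clampUnit u < A r y := by rw [← hQ u y]; exact hAmono y hr
      filter_upwards [hclamp.continuousAt.eventually_lt (x₀ := (u, y))
        ((hAcont r).comp continuous_snd).continuousAt this] with p hp
      rw [← hQ p.1 p.2] at hp
      exact (hAmono p.2).lt_iff_lt.1 hp
  refine ⟨Q, hQcont, hQA, fun y h hh => ?_⟩
  have hQy : Continuous fun u => Q u y :=
    hQcont.comp (by fun_prop : Continuous fun u : ℝ => (u, y))
  have hsub := intervalIntegral.integral_comp_mul_deriv (a := 0) (b := 1)
    (g := fun u => h (Q u y) * (m y / a (Q u y) y)) (fun x _ => hAderiv x y)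
    ((hay y).div_const _).continuousOn
    ((hh.comp hQy).mul (continuous_const.div ((hay y).comp hQy) fun u => (hapos _ y).ne'))
  simp only [hA0, hA1] at hsub
  rw [← hsub]
  refine intervalIntegral.integral_congr fun x hx => ?_
  rw [Set.uIcc_of_le zero_le_one] at hx
  have h1 := (hapos x y).ne'
  have h2 := (hmpos y).ne'
  simp only [Function.comp, hQA x hx]
  field_simp

/-- Sklar's theorem for a continuous family of positive densities `g · · y` of total mass `m y`. -/
lemma exists_copula_family {g : ℝ → ℝ → Y → ℝ} {a b : ℝ → Y → ℝ} {m : Y → ℝ}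
    (hg : Continuous fun p : ℝ × ℝ × Y => g p.1 p.2.1 p.2.2) (hgpos : ∀ x z y, 0 < g x z y)
    (ha : ∀ x y, a x y = ∫ z in (0 : ℝ)..1, g x z y)
    (hb : ∀ z y, b z y = ∫ x in (0 : ℝ)..1, g x z y)
    (hm : ∀ y, m y = ∫ x in (0 : ℝ)..1, a x y) :
    ∃ c : ℝ → ℝ → Y → ℝ, (Continuous fun p : ℝ × ℝ × Y => c p.1 p.2.1 p.2.2) ∧
      (∀ y, IsCopulaDensity fun u v => c u v y) ∧
      ∀ x ∈ Set.Icc (0 : ℝ) 1, ∀ z ∈ Set.Icc (0 : ℝ) 1, ∀ y,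
        g x z y * m y = a x y * b z y
          * c ((∫ t in (0 : ℝ)..x, a t y) / m y) ((∫ t in (0 : ℝ)..z, b t y) / m y) y := by
  have hgx (z : ℝ) (y : Y) : Continuous fun x => g x z y :=
    hg.comp (by fun_prop : Continuous fun x : ℝ => (x, z, y))
  have hgz (x : ℝ) (y : Y) : Continuous fun z => g x z y :=
    hg.comp (by fun_prop : Continuous fun z : ℝ => (x, z, y))
  have hacont : Continuous fun p : ℝ × Y => a p.1 p.2 := by
    simp only [ha]
    exact intervalIntegral.continuous_parametric_intervalIntegral_of_continuous'
      (f := fun (p : ℝ × Y) z => g p.1 z p.2)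
      (hg.comp (by fun_prop : Continuous fun q : (ℝ × Y) × ℝ => (q.1.1, q.2, q.1.2))) 0 1
  have hbcont : Continuous fun p : ℝ × Y => b p.1 p.2 := by
    simp only [hb]
    exact intervalIntegral.continuous_parametric_intervalIntegral_of_continuous'
      (f := fun (p : ℝ × Y) x => g x p.1 p.2)
      (hg.comp (by fun_prop : Continuous fun q : (ℝ × Y) × ℝ => (q.2, q.1.1, q.1.2))) 0 1
  have hapos (x : ℝ) (y : Y) : 0 < a x y := by
    rw [ha]
    exact intervalIntegral.intervalIntegral_pos_of_pos ((hgz x y).intervalIntegrable 0 1)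
      (hgpos x · y) one_pos
  have hbpos (z : ℝ) (y : Y) : 0 < b z y := by
    rw [hb]
    exact intervalIntegral.intervalIntegral_pos_of_pos ((hgx z y).intervalIntegrable 0 1)
      (hgpos · z y) one_pos
  have hmb (y : Y) : m y = ∫ z in (0 : ℝ)..1, b z y := by
    simp only [hm, ha, hb]
    exact integral_swap_of_continuous
      (hg.comp (by fun_prop : Continuous fun p : ℝ × ℝ => (p.1, p.2, y)))
  have hmcont : Continuous m := by
    simp only [funext hm]
    exact intervalIntegral.continuous_parametric_intervalIntegral_of_continuous'
      (f := fun y x => a x y) (hacont.comp continuous_swap) 0 1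
  have hmpos (y : Y) : 0 < m y := by
    rw [hm]
    exact intervalIntegral.intervalIntegral_pos_of_pos
      ((hacont.comp (by fun_prop : Continuous fun x : ℝ => (x, y))).intervalIntegrable 0 1)
      (hapos · y) one_pos
  obtain ⟨Q, hQcont, hQ, hQint⟩ := exists_continuous_quantile hacont hapos hm
  obtain ⟨R, hRcont, hR, hRint⟩ := exists_continuous_quantile hbcont hbpos hmb
  have hQ' : Continuous fun p : ℝ × ℝ × Y => Q p.1 p.2.2 :=
    hQcont.comp (by fun_prop : Continuous fun p : ℝ × ℝ × Y => (p.1, p.2.2))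
  have hR' : Continuous fun p : ℝ × ℝ × Y => R p.2.1 p.2.2 :=
    hRcont.comp (by fun_prop : Continuous fun p : ℝ × ℝ × Y => (p.2.1, p.2.2))
  let c : ℝ → ℝ → Y → ℝ := fun u v y =>
    g (Q u y) (R v y) y * m y / (a (Q u y) y * b (R v y) y)
  have hc : Continuous fun p : ℝ × ℝ × Y => c p.1 p.2.1 p.2.2 := by
    refine Continuous.div (.mul ?_ ?_) (.mul ?_ ?_)
      fun p => (mul_pos (hapos _ _) (hbpos _ _)).ne'
    · exact hg.comp (hQ'.prodMk (hR'.prodMk (by fun_prop)))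
    · exact hmcont.comp (by fun_prop)
    · exact hacont.comp (hQ'.prodMk (by fun_prop))
    · exact hbcont.comp (hR'.prodMk (by fun_prop))
  refine ⟨c, hc, fun y => ⟨?_, ?_, ?_, ?_⟩, fun x hx z hz y => ?_⟩
  · exact (hc.comp (by fun_prop : Continuous fun p : ℝ × ℝ => (p.1, p.2, y))).continuousOn
  · intro u _ v _
    exact (div_pos (mul_pos (hgpos _ _ _) (hmpos _)) (mul_pos (hapos _ _) (hbpos _ _))).le
  · intro u _
    have h := hRint y (fun z => g (Q u y) z y / a (Q u y) y) ((hgz _ y).div_const _)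
    rw [intervalIntegral.integral_div, ← ha, div_self (hapos _ y).ne'] at h
    refine Eq.trans (intervalIntegral.integral_congr fun v _ => ?_) h
    exact (div_mul_div_comm _ _ _ _).symm
  · intro v _
    have h := hQint y (fun x => g x (R v y) y / b (R v y) y) ((hgx _ y).div_const _)
    rw [intervalIntegral.integral_div, ← hb, div_self (hbpos _ y).ne'] at h
    refine Eq.trans (intervalIntegral.integral_congr fun u _ => ?_) h
    simp only [c]
    rw [div_mul_div_comm, mul_comm (b _ _)]
  · simp only [c, hQ x hx, hR z hz]
    rw [mul_div_cancel₀ _ (mul_pos (hapos x y) (hbpos z y)).ne']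

end Copula

/-- **D-vine decomposition of a four-variable density.** A continuous strictly positive
probability density `f` on `[0,1]⁴` factors along the four-variable D-vine into pair copulae
`c₁₂, c₂₃, c₃₄` (first tree), continuous families of copula densities `c₁₃|₂ (·,·;x₂)`,
`c₂₄|₃ (·,·;x₃)` (second tree) and `c₁₄|₂₃ (·,·;x₂,x₃)` (third tree), each conditional copula
being evaluated at the conditional distribution functions of its conditioning set. -/
theorem four_var_vine_decomposition (f : ℝ → ℝ → ℝ → ℝ → ℝ)
    (hfcont : ContinuousOn (fun p : ℝ × ℝ × ℝ × ℝ => f p.1 p.2.1 p.2.2.1 p.2.2.2)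
      ((Set.Icc (0:ℝ) 1) ×ˢ ((Set.Icc (0:ℝ) 1) ×ˢ ((Set.Icc (0:ℝ) 1) ×ˢ (Set.Icc (0:ℝ) 1)))))
    (hfpos : ∀ x1 ∈ Set.Icc (0:ℝ) 1, ∀ x2 ∈ Set.Icc (0:ℝ) 1, ∀ x3 ∈ Set.Icc (0:ℝ) 1,
      ∀ x4 ∈ Set.Icc (0:ℝ) 1, 0 < f x1 x2 x3 x4)
    (hftotal : (∫ x1 in (0:ℝ)..1, ∫ x2 in (0:ℝ)..1, ∫ x3 in (0:ℝ)..1, ∫ x4 in (0:ℝ)..1,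
      f x1 x2 x3 x4) = 1)
    -- univariate marginal densities
    (f1 f2 f3 f4 : ℝ → ℝ)
    (hf1 : ∀ x1, f1 x1 = ∫ s in (0:ℝ)..1, ∫ t in (0:ℝ)..1, ∫ w in (0:ℝ)..1, f x1 s t w)
    (hf2 : ∀ x2, f2 x2 = ∫ s in (0:ℝ)..1, ∫ t in (0:ℝ)..1, ∫ w in (0:ℝ)..1, f s x2 t w)
    (hf3 : ∀ x3, f3 x3 = ∫ s in (0:ℝ)..1, ∫ t in (0:ℝ)..1, ∫ w in (0:ℝ)..1, f s t x3 w)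
    (hf4 : ∀ x4, f4 x4 = ∫ s in (0:ℝ)..1, ∫ t in (0:ℝ)..1, ∫ w in (0:ℝ)..1, f s t w x4)
    -- bivariate marginal densities of adjacent pairs
    (f12 f23 f34 : ℝ → ℝ → ℝ)
    (hf12 : ∀ x1 x2, f12 x1 x2 = ∫ t in (0:ℝ)..1, ∫ w in (0:ℝ)..1, f x1 x2 t w)
    (hf23 : ∀ x2 x3, f23 x2 x3 = ∫ t in (0:ℝ)..1, ∫ w in (0:ℝ)..1, f t x2 x3 w)
    (hf34 : ∀ x3 x4, f34 x3 x4 = ∫ t in (0:ℝ)..1, ∫ w in (0:ℝ)..1, f t w x3 x4)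
    -- trivariate marginal densities
    (f123 f234 : ℝ → ℝ → ℝ → ℝ)
    (hf123 : ∀ x1 x2 x3, f123 x1 x2 x3 = ∫ w in (0:ℝ)..1, f x1 x2 x3 w)
    (hf234 : ∀ x2 x3 x4, f234 x2 x3 x4 = ∫ w in (0:ℝ)..1, f w x2 x3 x4)
    -- marginal CDFs
    (F1 F2 F3 F4 : ℝ → ℝ)
    (hF1 : ∀ x, F1 x = ∫ t in (0:ℝ)..x, f1 t)
    (hF2 : ∀ x, F2 x = ∫ t in (0:ℝ)..x, f2 t)
    (hF3 : ∀ x, F3 x = ∫ t in (0:ℝ)..x, f3 t)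
    (hF4 : ∀ x, F4 x = ∫ t in (0:ℝ)..x, f4 t)
    -- conditional CDFs given one variable
    (F12 F32 F23 F43 : ℝ → ℝ → ℝ)
    (hF12 : ∀ x1 x2, F12 x1 x2 = (∫ t in (0:ℝ)..x1, f12 t x2) / f2 x2)
    (hF32 : ∀ x3 x2, F32 x3 x2 = (∫ t in (0:ℝ)..x3, f23 x2 t) / f2 x2)
    (hF23 : ∀ x2 x3, F23 x2 x3 = (∫ t in (0:ℝ)..x2, f23 t x3) / f3 x3)
    (hF43 : ∀ x4 x3, F43 x4 x3 = (∫ t in (0:ℝ)..x4, f34 x3 t) / f3 x3)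
    -- conditional CDFs given two variables
    (F123 F423 : ℝ → ℝ → ℝ → ℝ)
    (hF123 : ∀ x1 x2 x3, F123 x1 x2 x3 = (∫ t in (0:ℝ)..x1, f123 t x2 x3) / f23 x2 x3)
    (hF423 : ∀ x4 x2 x3, F423 x4 x2 x3 = (∫ t in (0:ℝ)..x4, f234 x2 x3 t) / f23 x2 x3) :
    ∃ c12 c23 c34 : ℝ → ℝ → ℝ, ∃ c132 c243 : ℝ → ℝ → ℝ → ℝ, ∃ c1423 : ℝ → ℝ → ℝ → ℝ → ℝ,
      IsCopulaDensity c12 ∧ IsCopulaDensity c23 ∧ IsCopulaDensity c34 ∧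
      ContinuousOn (fun p : ℝ × ℝ × ℝ => c132 p.1 p.2.1 p.2.2)
        ((Set.Icc (0:ℝ) 1) ×ˢ ((Set.Icc (0:ℝ) 1) ×ˢ (Set.Icc (0:ℝ) 1))) ∧
      (∀ x2 ∈ Set.Icc (0:ℝ) 1, IsCopulaDensity (fun u w => c132 u w x2)) ∧
      ContinuousOn (fun p : ℝ × ℝ × ℝ => c243 p.1 p.2.1 p.2.2)
        ((Set.Icc (0:ℝ) 1) ×ˢ ((Set.Icc (0:ℝ) 1) ×ˢ (Set.Icc (0:ℝ) 1))) ∧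
      (∀ x3 ∈ Set.Icc (0:ℝ) 1, IsCopulaDensity (fun u w => c243 u w x3)) ∧
      ContinuousOn (fun p : ℝ × ℝ × ℝ × ℝ => c1423 p.1 p.2.1 p.2.2.1 p.2.2.2)
        ((Set.Icc (0:ℝ) 1) ×ˢ ((Set.Icc (0:ℝ) 1) ×ˢ ((Set.Icc (0:ℝ) 1) ×ˢ (Set.Icc (0:ℝ) 1)))) ∧
      (∀ x2 ∈ Set.Icc (0:ℝ) 1, ∀ x3 ∈ Set.Icc (0:ℝ) 1,
        IsCopulaDensity (fun u w => c1423 u w x2 x3)) ∧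
      ∀ x1 ∈ Set.Icc (0:ℝ) 1, ∀ x2 ∈ Set.Icc (0:ℝ) 1, ∀ x3 ∈ Set.Icc (0:ℝ) 1,
        ∀ x4 ∈ Set.Icc (0:ℝ) 1,
        f x1 x2 x3 x4 = f1 x1 * f2 x2 * f3 x3 * f4 x4
          * c12 (F1 x1) (F2 x2) * c23 (F2 x2) (F3 x3) * c34 (F3 x3) (F4 x4)
          * c132 (F12 x1 x2) (F32 x3 x2) x2
          * c243 (F23 x2 x3) (F43 x4 x3) x3
          * c1423 (F123 x1 x2 x3) (F423 x4 x2 x3) x2 x3 := by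
  let P := clampUnit
  have hP : Continuous P := continuous_clampUnit
  have hPI {x : ℝ} (hx : x ∈ Set.Icc (0 : ℝ) 1) : P x = x := clampUnit_of_mem hx
  have hcl (h : ℝ → ℝ) : ∫ t in (0 : ℝ)..1, h t = ∫ t in (0 : ℝ)..1, h (P t) :=
    (integral_comp_clampUnit h ⟨zero_le_one, le_rfl⟩).symm
  -- The clamped density and the recursive description of its marginals.
  have hf : Continuous fun p : ℝ × ℝ × ℝ × ℝ => f (P p.1) (P p.2.1) (P p.2.2.1) (P p.2.2.2) :=
    hfcont.comp_continuous
      (f := fun p : ℝ × ℝ × ℝ × ℝ => (P p.1, P p.2.1, P p.2.2.1, P p.2.2.2)) (by fun_prop)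
      fun p => ⟨clampUnit_mem _, clampUnit_mem _, clampUnit_mem _, clampUnit_mem _⟩
  have hpos (x1 x2 x3 x4 : ℝ) : 0 < f (P x1) (P x2) (P x3) (P x4) :=
    hfpos _ (clampUnit_mem _) _ (clampUnit_mem _) _ (clampUnit_mem _) _ (clampUnit_mem _)
  have e123 (x1 x2 x3 : ℝ) : f123 (P x1) (P x2) (P x3)
      = ∫ w in (0 : ℝ)..1, f (P x1) (P x2) (P x3) (P w) :=
    (hf123 _ _ _).trans (hcl _)
  have e234 (x2 x3 x4 : ℝ) : f234 (P x2) (P x3) (P x4)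
      = ∫ w in (0 : ℝ)..1, f (P w) (P x2) (P x3) (P x4) :=
    (hf234 _ _ _).trans (hcl _)
  have hc123 : Continuous fun p : ℝ × ℝ × ℝ => f123 (P p.1) (P p.2.1) (P p.2.2) := by
    simp only [e123]
    exact intervalIntegral.continuous_parametric_intervalIntegral_of_continuous'
      (f := fun (p : ℝ × ℝ × ℝ) w => f (P p.1) (P p.2.1) (P p.2.2) (P w))
      (hf.comp (by fun_prop :
        Continuous fun q : (ℝ × ℝ × ℝ) × ℝ => (q.1.1, q.1.2.1, q.1.2.2, q.2))) 0 1
  have hc234 : Continuous fun p : ℝ × ℝ × ℝ => f234 (P p.1) (P p.2.1) (P p.2.2) := by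
    simp only [e234]
    exact intervalIntegral.continuous_parametric_intervalIntegral_of_continuous'
      (f := fun (p : ℝ × ℝ × ℝ) w => f (P w) (P p.1) (P p.2.1) (P p.2.2))
      (hf.comp (by fun_prop :
        Continuous fun q : (ℝ × ℝ × ℝ) × ℝ => (q.2, q.1.1, q.1.2.1, q.1.2.2))) 0 1
  have hpos123 (x1 x2 x3 : ℝ) : 0 < f123 (P x1) (P x2) (P x3) := by
    rw [e123]
    exact intervalIntegral.intervalIntegral_pos_of_pos
      ((hf.comp (by fun_prop : Continuous fun w : ℝ => (x1, x2, x3, w))).intervalIntegrable 0 1)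
      (hpos x1 x2 x3) one_pos
  have hpos234 (x2 x3 x4 : ℝ) : 0 < f234 (P x2) (P x3) (P x4) := by
    rw [e234]
    exact intervalIntegral.intervalIntegral_pos_of_pos
      ((hf.comp (by fun_prop : Continuous fun w : ℝ => (w, x2, x3, x4))).intervalIntegrable 0 1)
      (hpos · x2 x3 x4) one_pos
  have e12 (x1 x2 : ℝ) : f12 (P x1) (P x2) = ∫ t in (0 : ℝ)..1, f123 (P x1) (P x2) (P t) := by
    simp only [hf12, ← hf123]
    exact hcl _
  have e23 (x2 x3 : ℝ) : f23 (P x2) (P x3) = ∫ t in (0 : ℝ)..1, f123 (P t) (P x2) (P x3) := by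
    simp only [hf23, ← hf123]
    exact hcl (fun t => f123 t (P x2) (P x3))
  have e34' (x3 x4 : ℝ) : f34 (P x3) (P x4)
      = ∫ t in (0 : ℝ)..1, ∫ w in (0 : ℝ)..1, f (P t) (P w) (P x3) (P x4) := by
    rw [hf34, hcl]
    exact intervalIntegral.integral_congr fun t _ => hcl (fun w => f (P t) w (P x3) (P x4))
  have e23' (x2 x3 : ℝ) : f23 (P x2) (P x3) = ∫ w in (0 : ℝ)..1, f234 (P x2) (P x3) (P w) := by
    simp only [e23, e123, e234]
    exact integral_swap_of_continuous
      (hf.comp (by fun_prop : Continuous fun p : ℝ × ℝ => (p.1, x2, x3, p.2)))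
  have e34 (x3 x4 : ℝ) : f34 (P x3) (P x4) = ∫ w in (0 : ℝ)..1, f234 (P w) (P x3) (P x4) := by
    simp only [e34', e234]
    exact integral_swap_of_continuous
      (hf.comp (by fun_prop : Continuous fun p : ℝ × ℝ => (p.1, p.2, x3, x4)))
  have hc12 : Continuous fun p : ℝ × ℝ => f12 (P p.1) (P p.2) := by
    simp only [e12]
    exact intervalIntegral.continuous_parametric_intervalIntegral_of_continuous'
      (f := fun (p : ℝ × ℝ) t => f123 (P p.1) (P p.2) (P t))
      (hc123.comp (by fun_prop : Continuous fun q : (ℝ × ℝ) × ℝ => (q.1.1, q.1.2, q.2))) 0 1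
  have hc23 : Continuous fun p : ℝ × ℝ => f23 (P p.1) (P p.2) := by
    simp only [e23]
    exact intervalIntegral.continuous_parametric_intervalIntegral_of_continuous'
      (f := fun (p : ℝ × ℝ) t => f123 (P t) (P p.1) (P p.2))
      (hc123.comp (by fun_prop : Continuous fun q : (ℝ × ℝ) × ℝ => (q.2, q.1.1, q.1.2))) 0 1
  have hc34 : Continuous fun p : ℝ × ℝ => f34 (P p.1) (P p.2) := by
    simp only [e34]
    exact intervalIntegral.continuous_parametric_intervalIntegral_of_continuous'
      (f := fun (p : ℝ × ℝ) t => f234 (P t) (P p.1) (P p.2))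
      (hc234.comp (by fun_prop : Continuous fun q : (ℝ × ℝ) × ℝ => (q.2, q.1.1, q.1.2))) 0 1
  have hpos12 (x1 x2 : ℝ) : 0 < f12 (P x1) (P x2) := by
    rw [e12]
    exact intervalIntegral.intervalIntegral_pos_of_pos
      ((hc123.comp (by fun_prop : Continuous fun t : ℝ => (x1, x2, t))).intervalIntegrable 0 1)
      (hpos123 x1 x2) one_pos
  have hpos23 (x2 x3 : ℝ) : 0 < f23 (P x2) (P x3) := by
    rw [e23]
    exact intervalIntegral.intervalIntegral_pos_of_pos
      ((hc123.comp (by fun_prop : Continuous fun t : ℝ => (t, x2, x3))).intervalIntegrable 0 1)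
      (hpos123 · x2 x3) one_pos
  have hpos34 (x3 x4 : ℝ) : 0 < f34 (P x3) (P x4) := by
    rw [e34]
    exact intervalIntegral.intervalIntegral_pos_of_pos
      ((hc234.comp (by fun_prop : Continuous fun t : ℝ => (t, x3, x4))).intervalIntegrable 0 1)
      (hpos234 · x3 x4) one_pos
  have e1 (x1 : ℝ) : f1 (P x1) = ∫ s in (0 : ℝ)..1, f12 (P x1) (P s) := by
    simp only [hf1, ← hf12]
    exact hcl _
  have e2 (x2 : ℝ) : f2 (P x2) = ∫ s in (0 : ℝ)..1, f12 (P s) (P x2) := by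
    simp only [hf2, ← hf12]
    exact hcl (fun s => f12 s (P x2))
  have e2' (x2 : ℝ) : f2 (P x2) = ∫ t in (0 : ℝ)..1, f23 (P x2) (P t) := by
    simp only [e2, e12, e23]
    exact integral_swap_of_continuous
      (hc123.comp (by fun_prop : Continuous fun p : ℝ × ℝ => (p.1, x2, p.2)))
  have e3 (x3 : ℝ) : f3 (P x3) = ∫ t in (0 : ℝ)..1, f23 (P t) (P x3) := by
    have h : f3 (P x3) = ∫ s in (0 : ℝ)..1, ∫ t in (0 : ℝ)..1, f123 (P s) (P t) (P x3) := by
      simp only [hf3, ← hf123]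
      rw [hcl]
      exact intervalIntegral.integral_congr fun s _ => hcl (fun t => f123 (P s) t (P x3))
    simp only [h, e23]
    exact integral_swap_of_continuous
      (hc123.comp (by fun_prop : Continuous fun p : ℝ × ℝ => (p.1, p.2, x3)))
  have e3' (x3 : ℝ) : f3 (P x3) = ∫ w in (0 : ℝ)..1, f34 (P x3) (P w) := by
    simp only [e3, e23', e34]
    exact integral_swap_of_continuous
      (hc234.comp (by fun_prop : Continuous fun p : ℝ × ℝ => (p.1, x3, p.2)))
  have e4 (x4 : ℝ) : f4 (P x4) = ∫ w in (0 : ℝ)..1, f34 (P w) (P x4) := by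
    have h : f4 (P x4) = ∫ s in (0 : ℝ)..1, ∫ t in (0 : ℝ)..1, ∫ w in (0 : ℝ)..1,
        f (P s) (P t) (P w) (P x4) := by
      rw [hf4, hcl]
      refine intervalIntegral.integral_congr fun s _ => ?_
      refine (hcl (fun t => ∫ w in (0 : ℝ)..1, f (P s) t w (P x4))).trans ?_
      exact intervalIntegral.integral_congr fun t _ => hcl (fun w => f (P s) (P t) w (P x4))
    simp only [h, e34']
    exact integral_rotate_of_continuous
      (hf.comp (by fun_prop : Continuous fun p : ℝ × ℝ × ℝ => (p.1, p.2.1, p.2.2, x4)))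
  have hpos2 (x2 : ℝ) : 0 < f2 (P x2) := by
    rw [e2]
    exact intervalIntegral.intervalIntegral_pos_of_pos
      ((hc12.comp (by fun_prop : Continuous fun t : ℝ => (t, x2))).intervalIntegrable 0 1)
      (hpos12 · x2) one_pos
  have hpos3 (x3 : ℝ) : 0 < f3 (P x3) := by
    rw [e3]
    exact intervalIntegral.intervalIntegral_pos_of_pos
      ((hc23.comp (by fun_prop : Continuous fun t : ℝ => (t, x3))).intervalIntegrable 0 1)
      (hpos23 · x3) one_pos
  have total1 : 1 = ∫ x in (0 : ℝ)..1, f1 (P x) := by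
    simp only [← hf1] at hftotal
    rw [← hcl, hftotal]
  have total2 : 1 = ∫ x in (0 : ℝ)..1, f2 (P x) := by
    refine total1.trans ?_
    simp only [e1, e2]
    exact integral_swap_of_continuous (h := fun x z => f12 (P x) (P z)) hc12
  have total3 : 1 = ∫ x in (0 : ℝ)..1, f3 (P x) := by
    refine total2.trans ?_
    simp only [e2', e3]
    exact integral_swap_of_continuous (h := fun x z => f23 (P x) (P z)) hc23
  -- The pair copulae, tree by tree.
  obtain ⟨c12, -, hc12cop, hc12eq⟩ := exists_copula_family (Y := Unit)
    (g := fun x z _ => f12 (P x) (P z)) (a := fun x _ => f1 (P x)) (b := fun z _ => f2 (P z))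
    (m := fun _ => 1)
    (hc12.comp (by fun_prop : Continuous fun p : ℝ × ℝ × Unit => (p.1, p.2.1)))
    (fun x z _ => hpos12 x z) (fun x _ => e1 x) (fun z _ => e2 z) (fun _ => total1)
  obtain ⟨c23, -, hc23cop, hc23eq⟩ := exists_copula_family (Y := Unit)
    (g := fun x z _ => f23 (P x) (P z)) (a := fun x _ => f2 (P x)) (b := fun z _ => f3 (P z))
    (m := fun _ => 1)
    (hc23.comp (by fun_prop : Continuous fun p : ℝ × ℝ × Unit => (p.1, p.2.1)))
    (fun x z _ => hpos23 x z) (fun x _ => e2' x) (fun z _ => e3 z) (fun _ => total2)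
  obtain ⟨c34, -, hc34cop, hc34eq⟩ := exists_copula_family (Y := Unit)
    (g := fun x z _ => f34 (P x) (P z)) (a := fun x _ => f3 (P x)) (b := fun z _ => f4 (P z))
    (m := fun _ => 1)
    (hc34.comp (by fun_prop : Continuous fun p : ℝ × ℝ × Unit => (p.1, p.2.1)))
    (fun x z _ => hpos34 x z) (fun x _ => e3' x) (fun z _ => e4 z) (fun _ => total3)
  obtain ⟨c132, hc132, hc132cop, hc132eq⟩ := exists_copula_family (Y := ℝ)
    (g := fun x z y => f123 (P x) (P y) (P z)) (a := fun x y => f12 (P x) (P y))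
    (b := fun z y => f23 (P y) (P z)) (m := fun y => f2 (P y))
    (hc123.comp (by fun_prop : Continuous fun p : ℝ × ℝ × ℝ => (p.1, p.2.2, p.2.1)))
    (fun x z y => hpos123 x y z) e12 (fun z y => e23 y z) e2
  obtain ⟨c243, hc243, hc243cop, hc243eq⟩ := exists_copula_family (Y := ℝ)
    (g := fun x z y => f234 (P x) (P y) (P z)) (a := fun x y => f23 (P x) (P y))
    (b := fun z y => f34 (P y) (P z)) (m := fun y => f3 (P y))
    (hc234.comp (by fun_prop : Continuous fun p : ℝ × ℝ × ℝ => (p.1, p.2.2, p.2.1)))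
    (fun x z y => hpos234 x y z) e23' (fun z y => e34 y z) e3
  obtain ⟨c1423, hc1423, hc1423cop, hc1423eq⟩ := exists_copula_family (Y := ℝ × ℝ)
    (g := fun x z y => f (P x) (P y.1) (P y.2) (P z))
    (a := fun x y => f123 (P x) (P y.1) (P y.2))
    (b := fun z y => f234 (P y.1) (P y.2) (P z)) (m := fun y => f23 (P y.1) (P y.2))
    (hf.comp (by fun_prop :
      Continuous fun p : ℝ × ℝ × ℝ × ℝ => (p.1, p.2.2.1, p.2.2.2, p.2.1)))
    (fun x z y => hpos x y.1 y.2 z) (fun x y => e123 x y.1 y.2) (fun z y => e234 y.1 y.2 z)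
    (fun y => e23 y.1 y.2)
  refine ⟨fun u v => c12 u v (), fun u v => c23 u v (), fun u v => c34 u v (), c132, c243,
    fun u v y z => c1423 u v (y, z), hc12cop (), hc23cop (), hc34cop (), hc132.continuousOn,
    fun y _ => hc132cop y, hc243.continuousOn, fun y _ => hc243cop y, hc1423.continuousOn,
    fun y _ z _ => hc1423cop (y, z), fun x1 h1 x2 h2 x3 h3 x4 h4 => ?_⟩
  have E12 := hc12eq x1 h1 x2 h2 ()
  have E23 := hc23eq x2 h2 x3 h3 ()
  have E34 := hc34eq x3 h3 x4 h4 ()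
  have E132 := hc132eq x1 h1 x3 h3 x2
  have E243 := hc243eq x2 h2 x4 h4 x3
  have E1423 := hc1423eq x1 h1 x4 h4 (x2, x3)
  have p2 := hpos2 x2
  have p3 := hpos3 x3
  have p23 := hpos23 x2 x3
  simp only [hPI h1, hPI h2, hPI h3, hPI h4, mul_one, div_one]
    at E12 E23 E34 E132 E243 E1423 p2 p3 p23
  rw [integral_comp_clampUnit f1 h1, integral_comp_clampUnit f2 h2, ← hF1, ← hF2] at E12
  rw [integral_comp_clampUnit f2 h2, integral_comp_clampUnit f3 h3, ← hF2, ← hF3] at E23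
  rw [integral_comp_clampUnit f3 h3, integral_comp_clampUnit f4 h4, ← hF3, ← hF4] at E34
  rw [integral_comp_clampUnit (f12 · x2) h1, integral_comp_clampUnit (f23 x2) h3,
    ← hF12, ← hF32] at E132
  rw [integral_comp_clampUnit (f23 · x3) h2, integral_comp_clampUnit (f34 x3) h4,
    ← hF23, ← hF43] at E243
  rw [integral_comp_clampUnit (f123 · x2 x3) h1, integral_comp_clampUnit (f234 x2 x3) h4,
    ← hF123, ← hF423] at E1423
  beta_reduce
  generalize c12 (F1 x1) (F2 x2) () = k12 at E12 ⊢
  generalize c23 (F2 x2) (F3 x3) () = k23 at E23 ⊢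
  generalize c34 (F3 x3) (F4 x4) () = k34 at E34 ⊢
  generalize c132 (F12 x1 x2) (F32 x3 x2) x2 = k132 at E132 ⊢
  generalize c243 (F23 x2 x3) (F43 x4 x3) x3 = k243 at E243 ⊢
  generalize c1423 (F123 x1 x2 x3) (F423 x4 x2 x3) (x2, x3) = k1423 at E1423 ⊢
  refine mul_right_cancel₀ (mul_pos (mul_pos p2 p3) p23).ne' ?_
  calc f x1 x2 x3 x4 * (f2 x2 * f3 x3 * f23 x2 x3)
      = (f x1 x2 x3 x4 * f23 x2 x3) * f2 x2 * f3 x3 := by ring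
    _ = (f123 x1 x2 x3 * f2 x2) * (f234 x2 x3 x4 * f3 x3) * k1423 := by rw [E1423]; ring
    _ = f12 x1 x2 * f23 x2 x3 * f34 x3 x4 * k132 * k243 * k1423 * f23 x2 x3 := by
      rw [E132, E243]; ring
    _ = (f1 x1 * f2 x2 * k12) * (f2 x2 * f3 x3 * k23) * (f3 x3 * f4 x4 * k34)
          * k132 * k243 * k1423 * f23 x2 x3 := by rw [← E12, ← E23, ← E34]
    _ = _ := by ring
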